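/- arXiv:math/0607142 — 7 statements merged into one kernel-verified Lean document; each statement's English description precedes it below -/
import Mathlib

section
/- Let A be an n×n real symmetric matrix with eigenvalues λ_1 ≥ λ_2 ≥ … ≥ λ_n (listed with multiplicity) and an orthonormal basis p_1, …, p_n of ℝ^n with A p_j = λ_j p_j for each j. Suppose λ_i is a simple eigenvalue of A, i.e. λ_j ≠ λ_i for all j ≠ i. Then for every index m, det(A_m − λ_i I_{n−1}) = ((p_i)_m)^2 · ∏_{j ≠ i} (λ_j − λ_i), where (p_i)_m denotes the m-th entry of p_i. -/
open Matrix BigOperators Finset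

/-- The adjugate of an orthogonal conjugate of a diagonal matrix. -/
theorem adjugate_transpose_mul_diagonal_mul {ι R : Type*} [Fintype ι] [DecidableEq ι]
    [CommRing R] (P : Matrix ι ι R) (hP : P * Pᵀ = 1) (d : ι → R) :
    adjugate (Pᵀ * diagonal d * P) =
      Pᵀ * diagonal (fun j => ∏ k ∈ Finset.univ.erase j, d k) * P := by
  have hP' : Pᵀ * P = 1 := mul_eq_one_comm.mp hP
  have hdet : P.det * P.det = 1 := by
    simpa using congrArg det hP
  have hadj : adjugate P = P.det • Pᵀ := by
    calc adjugate P = Pᵀ * P * adjugate P := by rw [hP', one_mul]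
      _ = P.det • Pᵀ := by rw [mul_assoc, mul_adjugate, Matrix.mul_smul, mul_one]
  rw [adjugate_mul_distrib, adjugate_mul_distrib, ← adjugate_transpose, hadj, adjugate_diagonal,
    transpose_smul, transpose_transpose, Matrix.mul_smul, Matrix.smul_mul, Matrix.mul_smul,
    smul_smul, hdet, one_smul, mul_assoc]

/-- Let `A` be an `(n+1) × (n+1)` real symmetric matrix with eigenvalues
`lam 0 ≥ lam 1 ≥ …` (with multiplicity) and an orthonormal basis `p j` of eigenvectors,
`A (p j) = lam j • p j`.  If `lam i` is a simple eigenvalue (`lam j ≠ lam i` for `j ≠ i`),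
then for every index `m`,
`det (A_m - lam i • I) = (p i m)^2 * ∏_{j ≠ i} (lam j - lam i)`,
where `A_m` is obtained from `A` by deleting the `m`-th row and column. -/
theorem square_entry_det_deleted {n : ℕ}
    (A : Matrix (Fin (n + 1)) (Fin (n + 1)) ℝ) (hA : A.IsSymm)
    (lam : Fin (n + 1) → ℝ) (hmono : Antitone lam)
    (p : Fin (n + 1) → (Fin (n + 1) → ℝ))
    (horth : ∀ j k, p j ⬝ᵥ p k = if j = k then (1 : ℝ) else 0)
    (heig : ∀ j, A.mulVec (p j) = lam j • p j)
    (i : Fin (n + 1)) (hsimple : ∀ j, j ≠ i → lam j ≠ lam i)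
    (m : Fin (n + 1)) :
    (A.submatrix m.succAbove m.succAbove - lam i • (1 : Matrix (Fin n) (Fin n) ℝ)).det
      = (p i m) ^ 2 * ∏ j ∈ Finset.univ.erase i, (lam j - lam i) := by
  set P : Matrix (Fin (n + 1)) (Fin (n + 1)) ℝ := of p with hPdef
  have hP : P * Pᵀ = 1 := by
    ext j k
    rw [one_apply, ← horth j k]
    rfl
  have hP' : Pᵀ * P = 1 := mul_eq_one_comm.mp hP
  have hAP : A * Pᵀ = Pᵀ * diagonal lam := by
    ext j k
    rw [mul_diagonal, mul_comm]
    exact congrFun (heig k) j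
  have hdiag : A - lam i • 1 = Pᵀ * diagonal (fun j => lam j - lam i) * P := by
    have hsub : diagonal (fun j => lam j - lam i) = diagonal lam - lam i • 1 := by
      rw [smul_one_eq_diagonal, diagonal_sub]
    rw [hsub, mul_sub, ← hAP, sub_mul, mul_assoc, hP', mul_one, Matrix.mul_smul, mul_one,
      Matrix.smul_mul, hP']
  have hminor : A.submatrix m.succAbove m.succAbove - lam i • (1 : Matrix (Fin n) (Fin n) ℝ) =
      (A - lam i • 1).submatrix m.succAbove m.succAbove := by
    ext j k
    simp [one_apply]
  have hadj := adjugate_fin_succ_eq_det_submatrix (A - lam i • 1) m m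
  rw [Even.neg_one_pow ⟨_, rfl⟩, one_mul] at hadj
  rw [hminor, ← hadj, hdiag, adjugate_transpose_mul_diagonal_mul P hP, mul_apply,
    Finset.sum_eq_single i]
  · rw [mul_diagonal, transpose_apply, hPdef, of_apply]
    ring
  · intro j _ hj
    rw [mul_diagonal, Finset.prod_eq_zero (Finset.mem_erase.mpr ⟨hj.symm, Finset.mem_univ i⟩)
      (sub_self _), mul_zero, zero_mul]
  · simp
end

section
/- Let A be an n×n real symmetric matrix with eigenvalues λ_1 ≥ λ_2 ≥ … ≥ λ_n (listed with multiplicity) and an orthonormal basis p_1, …, p_n of ℝ^n with A p_j = λ_j p_j for each j. Suppose λ_i is a simple eigenvalue of A, i.e. λ_j ≠ λ_i for all j ≠ i. Fix an index m and let μ_1 ≥ μ_2 ≥ … ≥ μ_{n−1} be the eigenvalues of A_m (listed with multiplicity). Then ((p_i)_m)^2 = (∏_{j=1}^{n−1} (μ_j − λ_i)) / (∏_{j ≠ i} (λ_j − λ_i)). -/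
open Matrix BigOperators Finset Polynomial

/-- The adjugate of an orthogonal conjugate `U D Uᵀ` is the conjugate `U (adj D) Uᵀ`. -/
theorem Matrix.adjugate_orthogonal_conj {ι R : Type*} [Fintype ι] [DecidableEq ι] [CommRing R]
    {U : Matrix ι ι R} (hU : U * Uᵀ = 1) (D : Matrix ι ι R) :
    (U * D * Uᵀ).adjugate = U * D.adjugate * Uᵀ := by
  have hdet : U.det * U.det = 1 := by
    simpa using congrArg Matrix.det hU
  have adj_eq : U.adjugate = U.det • Uᵀ := by
    calc U.adjugate = U.adjugate * (U * Uᵀ) := by rw [hU, mul_one]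
      _ = U.det • Uᵀ := by rw [← mul_assoc, adjugate_mul, smul_mul_assoc, one_mul]
  have adj_transpose_eq : Uᵀ.adjugate = U.det • U := by
    rw [← adjugate_transpose, adj_eq, transpose_smul, transpose_transpose]
  rw [adjugate_mul_distrib, adjugate_mul_distrib, adj_eq, adj_transpose_eq]
  simp only [smul_mul_assoc, mul_smul_comm, smul_smul, hdet, one_smul, mul_assoc]

/-- Diagonal entries of the adjugate of a matrix diagonalised by an orthogonal matrix. -/
theorem Matrix.adjugate_orthogonal_conj_diagonal_apply_self {ι R : Type*} [Fintype ι]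
    [DecidableEq ι] [CommRing R] {U : Matrix ι ι R} (hU : U * Uᵀ = 1) (d : ι → R) (m : ι) :
    (U * diagonal d * Uᵀ).adjugate m m = ∑ j, U m j ^ 2 * ∏ k ∈ Finset.univ.erase j, d k := by
  rw [adjugate_orthogonal_conj hU, adjugate_diagonal, mul_apply]
  refine Finset.sum_congr rfl fun j _ => ?_
  rw [mul_diagonal, transpose_apply]
  ring

/-- A diagonal entry of the adjugate is the corresponding principal minor. -/
theorem Matrix.adjugate_apply_self_eq_det_submatrix {R : Type*} [CommRing R] {n : ℕ}
    (B : Matrix (Fin (n + 1)) (Fin (n + 1)) R) (m : Fin (n + 1)) :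
    B.adjugate m m = (B.submatrix m.succAbove m.succAbove).det := by
  rw [adjugate_fin_succ_eq_det_submatrix, Even.neg_one_pow ⟨_, rfl⟩, one_mul]

/-- If the characteristic polynomial of `B` splits with roots `mu`, then
`det (B - x) = ∏ j, (mu j - x)`. -/
theorem Matrix.det_sub_scalar_of_charpoly_eq_prod {R : Type*} [CommRing R] {n : ℕ}
    {B : Matrix (Fin n) (Fin n) R} {mu : Fin n → R} (hB : B.charpoly = ∏ j, (X - C (mu j)))
    (x : R) : (B - scalar (Fin n) x).det = ∏ j, (mu j - x) := by
  have h : (scalar (Fin n) x - B).det = ∏ j, (x - mu j) := by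
    rw [← eval_charpoly, hB, eval_prod]
    simp
  rw [← neg_sub, det_neg, h, Fintype.card_fin]
  simp_rw [← neg_sub x, Finset.prod_neg, Finset.card_univ, Fintype.card_fin]

/-- Let `A` be an `(n+1) × (n+1)` real symmetric matrix with eigenvalues
`lam 0 ≥ lam 1 ≥ …` (with multiplicity) and an orthonormal eigenbasis `p j`.  Suppose
`lam i` is a simple eigenvalue.  Fix `m` and let `mu 0 ≥ mu 1 ≥ …` be the eigenvalues of
the matrix `A_m` obtained by deleting the `m`-th row and column (listed with multiplicity,
i.e. its characteristic polynomial is `∏ j, (X - mu j)`).  Then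
`(p i m)^2 = (∏ j, (mu j - lam i)) / (∏_{j ≠ i} (lam j - lam i))`. -/
theorem square_entry_eq_ratio {n : ℕ}
    (A : Matrix (Fin (n + 1)) (Fin (n + 1)) ℝ) (hA : A.IsSymm)
    (lam : Fin (n + 1) → ℝ) (hmono : Antitone lam)
    (p : Fin (n + 1) → (Fin (n + 1) → ℝ))
    (horth : ∀ j k, p j ⬝ᵥ p k = if j = k then (1 : ℝ) else 0)
    (heig : ∀ j, A.mulVec (p j) = lam j • p j)
    (i : Fin (n + 1)) (hsimple : ∀ j, j ≠ i → lam j ≠ lam i)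
    (m : Fin (n + 1))
    (mu : Fin n → ℝ) (hmu : Antitone mu)
    (hchar : (A.submatrix m.succAbove m.succAbove).charpoly = ∏ j, (X - C (mu j))) :
    (p i m) ^ 2
      = (∏ j, (mu j - lam i)) / (∏ j ∈ Finset.univ.erase i, (lam j - lam i)) := by
  have hP : (of p)ᵀ * (of p)ᵀᵀ = 1 := by
    rw [transpose_transpose, mul_eq_one_comm]
    ext j k
    simpa [mul_apply, dotProduct, one_apply] using horth j k
  have hAP : (A - scalar (Fin (n + 1)) (lam i)) * (of p)ᵀ
      = (of p)ᵀ * diagonal fun j => lam j - lam i := by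
    ext k j
    have h := congrFun (heig j) k
    rw [sub_mul, Matrix.sub_apply, mul_diagonal, scalar_apply, diagonal_mul]
    simp only [mulVec, dotProduct, Pi.smul_apply, smul_eq_mul] at h
    simp only [mul_apply, transpose_apply, of_apply, h]
    ring
  have hspec : A - scalar (Fin (n + 1)) (lam i)
      = (of p)ᵀ * (diagonal fun j => lam j - lam i) * (of p)ᵀᵀ := by
    rw [← hAP, mul_assoc, hP, mul_one]
  have hsub : (A - scalar (Fin (n + 1)) (lam i)).submatrix m.succAbove m.succAbove
      = A.submatrix m.succAbove m.succAbove - scalar (Fin n) (lam i) := by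
    ext j k
    simp [diagonal_apply]
  have hprod : ∏ j ∈ Finset.univ.erase i, (lam j - lam i) ≠ 0 :=
    Finset.prod_ne_zero_iff.mpr fun j hj =>
      sub_ne_zero.mpr (hsimple j (Finset.ne_of_mem_erase hj))
  rw [eq_div_iff hprod, ← det_sub_scalar_of_charpoly_eq_prod hchar, ← hsub,
    ← adjugate_apply_self_eq_det_submatrix, hspec,
    adjugate_orthogonal_conj_diagonal_apply_self hP, Finset.sum_eq_single i]
  · rfl
  · intro j _ hj
    rw [Finset.prod_eq_zero (Finset.mem_erase.mpr ⟨hj.symm, Finset.mem_univ i⟩) (sub_self _),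
      mul_zero]
  · simp
end

section
/- Let A and B be n×n real symmetric matrices such that A and B have the same multiset of eigenvalues, and for every index m the matrices A_m and B_m have the same multiset of eigenvalues. Let λ be a simple eigenvalue of A (and hence of B). Let p be a unit vector in ℝ^n with A p = λ p and q a unit vector with B q = λ q. Then (p_j)^2 = (q_j)^2 for every j ∈ {1,…,n}. -/
open Matrix BigOperators Finset

section AdjugateKernel

variable {ι K : Type*} [Fintype ι] [DecidableEq ι] [Field K]

/-- If a diagonal cofactor of `M` is nonzero, then the kernel of `M` is at most a line. -/
theorem Matrix.exists_eq_smul_of_adjugate_ne_zero {M : Matrix ι ι K} {i : ι}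
    (hM : M.adjugate i i ≠ 0) {p x : ι → K} (hp0 : p ≠ 0) (hp : M *ᵥ p = 0) (hx : M *ᵥ x = 0) :
    ∃ c : K, x = c • p := by
  have eq_zero {y : ι → K} (hy : M *ᵥ y = 0) (hyi : y i = 0) : y = 0 := by
    by_contra hy0
    refine hM ?_
    rw [adjugate_apply, ← exists_mulVec_eq_zero_iff]
    refine ⟨y, hy0, ?_⟩
    ext k
    rcases eq_or_ne k i with rfl | hk
    · simp [mulVec, hyi]
    · simpa [mulVec, updateRow_ne hk] using congrFun hy k
  have hpi : p i ≠ 0 := fun h => hp0 (eq_zero hp h)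
  refine ⟨x i / p i, sub_eq_zero.mp (eq_zero ?_ ?_)⟩
  · rw [mulVec_sub, mulVec_smul, hx, hp, smul_zero, sub_zero]
  · simp [hpi]

/-- If the kernel of a symmetric matrix is spanned by `p`, then the diagonal cofactors are
nonzero wherever `p` is. -/
theorem Matrix.IsSymm.adjugate_apply_self_ne_zero {M : Matrix ι ι K} (hM : M.IsSymm)
    {p : ι → K} (hp : M *ᵥ p = 0) (hker : ∀ x, M *ᵥ x = 0 → ∃ c : K, x = c • p)
    {i : ι} (hpi : p i ≠ 0) : M.adjugate i i ≠ 0 := by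
  rw [adjugate_apply, Ne, ← exists_mulVec_eq_zero_iff]
  rintro ⟨v, hv0, hv⟩
  have hvi : v i = 0 := by simpa [mulVec] using congrFun hv i
  have hvk {k : ι} (hk : k ≠ i) : (M *ᵥ v) k = 0 := by
    simpa [mulVec, updateRow_ne hk] using congrFun hv k
  have hdot : p ⬝ᵥ M *ᵥ v = 0 := by
    rw [dotProduct_mulVec, ← mulVec_transpose, hM.eq, hp, zero_dotProduct]
  have hMvi : (M *ᵥ v) i = 0 := by
    rw [dotProduct, Finset.sum_eq_single i (fun k _ hk => by rw [hvk hk, mul_zero])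
      (by simp)] at hdot
    exact (mul_eq_zero.mp hdot).resolve_left hpi
  obtain ⟨c, rfl⟩ := hker v <| by
    ext k
    rcases eq_or_ne k i with rfl | hk
    exacts [hMvi, hvk hk]
  have hc : c = 0 := by simpa [hpi] using hvi
  exact hv0 (by rw [hc, zero_smul])

/-- If the kernel of a symmetric matrix `M` is spanned by a unit vector `p`, then the diagonal of
the adjugate of `M` is that of `M.adjugate.trace • p pᵀ`. -/
theorem Matrix.IsSymm.adjugate_apply_self_eq_trace_mul_sq {M : Matrix ι ι K} (hM : M.IsSymm)
    {p : ι → K} (hpu : p ⬝ᵥ p = 1) (hp : M *ᵥ p = 0)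
    (hker : ∀ x, M *ᵥ x = 0 → ∃ c : K, x = c • p) (j : ι) :
    M.adjugate j j = M.adjugate.trace * p j ^ 2 := by
  have hdet : M.det = 0 :=
    exists_mulVec_eq_zero_iff.mp ⟨p, by rintro rfl; simp at hpu, hp⟩
  have hcol (k : ι) : ∃ c : K, M.adjugate.col k = c • p := by
    refine hker _ ?_
    ext i
    have h := congrFun (congrFun M.mul_adjugate i) k
    simpa [hdet, mul_apply, mulVec, dotProduct] using h
  choose a ha using hcol
  have hadj (i k : ι) : M.adjugate i k = a k * p i := by
    simpa using congrFun (ha k) i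
  have hsymm (i k : ι) : a k * p i = a i * p k := by
    rw [← hadj, ← hadj, hM.adjugate.apply]
  have haj : a j = M.adjugate.trace * p j := by
    calc a j = a j * p ⬝ᵥ p := by rw [hpu, mul_one]
      _ = ∑ i, a j * p i * p i := by simp [dotProduct, Finset.mul_sum, mul_assoc]
      _ = ∑ i, a i * p i * p j := by
        refine Finset.sum_congr rfl fun i _ => ?_
        rw [hsymm i j]; ring
      _ = M.adjugate.trace * p j := by simp [trace, hadj, Finset.sum_mul]
  rw [hadj, haj]; ring

end AdjugateKernel

theorem Matrix.adjugate_scalar_sub_apply_self {R : Type*} [CommRing R] {n : ℕ}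
    (A : Matrix (Fin (n + 1)) (Fin (n + 1)) R) (r : R) (m : Fin (n + 1)) :
    (scalar (Fin (n + 1)) r - A).adjugate m m =
      (A.submatrix m.succAbove m.succAbove).charpoly.eval r := by
  rw [adjugate_fin_succ_eq_det_submatrix, eval_charpoly, Even.neg_one_pow ⟨_, rfl⟩, one_mul]
  congr 1
  ext i k
  simp [diagonal_apply]

/-- Let `A`, `B` be `(n+1) × (n+1)` real symmetric matrices with the same
multiset of eigenvalues (same characteristic polynomial), and such that for every `m` the
deleted matrices `A_m` and `B_m` have the same multiset of eigenvalues.  Let `lam` be a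
simple eigenvalue of `A` (and hence of `B`), `p` a unit eigenvector of `A` for `lam` and
`q` a unit eigenvector of `B` for `lam`.  Then `(p j)^2 = (q j)^2` for all `j`. -/
theorem sq_entries_eq_of_same_spectra {n : ℕ}
    (A B : Matrix (Fin (n + 1)) (Fin (n + 1)) ℝ) (hA : A.IsSymm) (hB : B.IsSymm)
    (hspec : A.charpoly = B.charpoly)
    (hspec' : ∀ m : Fin (n + 1),
      (A.submatrix m.succAbove m.succAbove).charpoly
        = (B.submatrix m.succAbove m.succAbove).charpoly)
    (lam : ℝ)
    (hsimple : Module.finrank ℝ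
      (LinearMap.ker ((A - lam • (1 : Matrix (Fin (n + 1)) (Fin (n + 1)) ℝ)).mulVecLin)) = 1)
    (p q : Fin (n + 1) → ℝ)
    (hp : A.mulVec p = lam • p) (hpu : p ⬝ᵥ p = 1)
    (hq : B.mulVec q = lam • q) (hqu : q ⬝ᵥ q = 1) :
    ∀ j, (p j) ^ 2 = (q j) ^ 2 := by
  have mulVec_eq_zero {C : Matrix (Fin (n + 1)) (Fin (n + 1)) ℝ} {v : Fin (n + 1) → ℝ}
      (hv : C *ᵥ v = lam • v) : (scalar (Fin (n + 1)) lam - C) *ᵥ v = 0 := by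
    rw [sub_mulVec, hv, scalar_apply, ← smul_one_eq_diagonal, smul_mulVec, one_mulVec, sub_self]
  have isSymm_sub {C : Matrix (Fin (n + 1)) (Fin (n + 1)) ℝ} (hC : C.IsSymm) :
      (scalar (Fin (n + 1)) lam - C).IsSymm := (isSymm_diagonal _).sub hC
  have ne_zero {v : Fin (n + 1) → ℝ} (hv : v ⬝ᵥ v = 1) : v ≠ 0 := by
    rintro rfl
    simp at hv
  have hadj (m : Fin (n + 1)) : (scalar (Fin (n + 1)) lam - A).adjugate m m =
      (scalar (Fin (n + 1)) lam - B).adjugate m m := by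
    rw [adjugate_scalar_sub_apply_self, adjugate_scalar_sub_apply_self, hspec' m]
  have htrace : (scalar (Fin (n + 1)) lam - A).adjugate.trace =
      (scalar (Fin (n + 1)) lam - B).adjugate.trace := Finset.sum_congr rfl fun m _ => hadj m
  have mem_ker_iff (x : Fin (n + 1) → ℝ) :
      x ∈ LinearMap.ker ((A - lam • (1 : Matrix (Fin (n + 1)) (Fin (n + 1)) ℝ)).mulVecLin) ↔
        (scalar (Fin (n + 1)) lam - A) *ᵥ x = 0 := by
    rw [LinearMap.mem_ker, mulVecLin_apply, ← neg_eq_zero, ← neg_mulVec, neg_sub, scalar_apply,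
      smul_one_eq_diagonal]
  have hkerA (x : Fin (n + 1) → ℝ) (hx : (scalar (Fin (n + 1)) lam - A) *ᵥ x = 0) :
      ∃ c : ℝ, x = c • p := by
    obtain ⟨c, hc⟩ := (finrank_eq_one_iff_of_nonzero'
      (⟨p, (mem_ker_iff p).mpr (mulVec_eq_zero hp)⟩ : LinearMap.ker _)
      (fun h => ne_zero hpu (congrArg Subtype.val h))).mp hsimple ⟨x, (mem_ker_iff x).mpr hx⟩
    exact ⟨c, (congrArg Subtype.val hc).symm⟩
  obtain ⟨i, hpi⟩ := Function.ne_iff.mp (ne_zero hpu)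
  have hAi := (isSymm_sub hA).adjugate_apply_self_ne_zero (mulVec_eq_zero hp) hkerA hpi
  have hkerB (x : Fin (n + 1) → ℝ) (hx : (scalar (Fin (n + 1)) lam - B) *ᵥ x = 0) :
      ∃ c : ℝ, x = c • q :=
    exists_eq_smul_of_adjugate_ne_zero (hadj i ▸ hAi) (ne_zero hqu) (mulVec_eq_zero hq) hx
  have hdiagA :=
    (isSymm_sub hA).adjugate_apply_self_eq_trace_mul_sq hpu (mulVec_eq_zero hp) hkerA
  have hdiagB :=
    (isSymm_sub hB).adjugate_apply_self_eq_trace_mul_sq hqu (mulVec_eq_zero hq) hkerB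
  have htrace0 : (scalar (Fin (n + 1)) lam - A).adjugate.trace ≠ 0 :=
    left_ne_zero_of_mul (hdiagA i ▸ hAi)
  intro j
  apply mul_left_cancel₀ htrace0
  rw [← hdiagA, hadj, hdiagB, htrace]
end

section
/- Let A and B be hypomorphic n×n real symmetric matrices. Let λ be a simple eigenvalue of both A and B. Let p be a unit vector in ℝ^n with A p = λ p and q a unit vector with B q = λ q. Then (p_j)^2 = (q_j)^2 for every j ∈ {1,…,n}. -/
open Matrix BigOperators Finset

/-- Two `(n+1) × (n+1)` real symmetric matrices are *hypomorphic* if for every index `i`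
the matrix `B_i` (delete the `i`-th row and column of `B`) is obtained from `A_i` by
simultaneously permuting rows and columns: `B_i = P_i * A_i * P_iᵀ` for a permutation
matrix `P_i`. -/
def Hypomorphic {n : ℕ} (A B : Matrix (Fin (n + 1)) (Fin (n + 1)) ℝ) : Prop :=
  ∀ i : Fin (n + 1), ∃ σ : Equiv.Perm (Fin n),
    B.submatrix i.succAbove i.succAbove
      = σ.permMatrix ℝ * A.submatrix i.succAbove i.succAbove * (σ.permMatrix ℝ)ᵀ

/-- A vector in a one-dimensional kernel is a multiple of any nonzero kernel vector. -/
theorem exists_smul_of_finrank_ker_eq_one {m : Type*} [Fintype m] (M : Matrix m m ℝ)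
    (hM : Module.finrank ℝ (LinearMap.ker M.mulVecLin) = 1) {p : m → ℝ} (hp : M *ᵥ p = 0)
    (hp0 : p ≠ 0) {x : m → ℝ} (hx : M *ᵥ x = 0) : ∃ c : ℝ, x = c • p := by
  have hp' : p ∈ LinearMap.ker M.mulVecLin := by simpa using hp
  have hx' : x ∈ LinearMap.ker M.mulVecLin := by simpa using hx
  obtain ⟨c, hc⟩ := exists_smul_eq_of_finrank_eq_one hM (x := ⟨p, hp'⟩)
    (by simpa [Subtype.ext_iff] using hp0) ⟨x, hx'⟩
  exact ⟨c, by simpa using (congrArg Subtype.val hc).symm⟩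

/-- The diagonal entries of the adjugate are the principal minors. -/
theorem adjugate_diag_eq_det_submatrix {n : ℕ} (M : Matrix (Fin (n + 1)) (Fin (n + 1)) ℝ)
    (j : Fin (n + 1)) : M.adjugate j j = (M.submatrix j.succAbove j.succAbove).det := by
  rw [adjugate_fin_succ_eq_det_submatrix, Even.neg_one_pow ⟨_, rfl⟩, one_mul]

/-- The diagonal of the adjugate of a symmetric matrix with one-dimensional kernel spanned by the
unit vector `p` is proportional to the entrywise square of `p`. -/
theorem adjugate_diag_eq_mul_sq {m : Type*} [Fintype m] [DecidableEq m] (M : Matrix m m ℝ)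
    (hS : M.IsSymm) (hM : Module.finrank ℝ (LinearMap.ker M.mulVecLin) = 1) {p : m → ℝ}
    (hp : M *ᵥ p = 0) (hpu : p ⬝ᵥ p = 1) : ∃ c : ℝ, ∀ j, M.adjugate j j = c * p j ^ 2 := by
  have hp0 : p ≠ 0 := by
    rintro rfl
    simp at hpu
  have hdet : M.det = 0 := exists_mulVec_eq_zero_iff.mp ⟨p, hp0, hp⟩
  have hcol : ∀ j, ∃ c : ℝ, (fun i => M.adjugate i j) = c • p := fun j => by
    refine exists_smul_of_finrank_ker_eq_one M hM hp hp0 ?_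
    ext i
    have h := congrFun (congrFun (mul_adjugate M) i) j
    simpa [hdet, mul_apply, mulVec, dotProduct] using h
  choose w hw using hcol
  have hadj : ∀ i j, M.adjugate i j = w j * p i := fun i j => by
    simpa using congrFun (hw j) i
  have hsymm : ∀ i j, w j * p i = w i * p j := fun i j => by
    have hT : M.adjugateᵀ = M.adjugate := by rw [adjugate_transpose, hS.eq]
    rw [← hadj, ← hadj, ← transpose_apply M.adjugate, hT]
  refine ⟨w ⬝ᵥ p, fun j => ?_⟩
  have hwj : w j = (w ⬝ᵥ p) * p j := by
    calc w j = w j * (p ⬝ᵥ p) := by rw [hpu, mul_one]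
      _ = ∑ i, (w j * p i) * p i := by simp [dotProduct, Finset.mul_sum, mul_assoc]
      _ = ∑ i, (w i * p i) * p j := Finset.sum_congr rfl fun i _ => by rw [hsymm]; ring
      _ = (w ⬝ᵥ p) * p j := by rw [dotProduct, Finset.sum_mul]
  rw [hadj, hwj]
  ring

/-- If the kernel of a symmetric matrix is spanned by `p` and `p j ≠ 0`, then the principal
minor obtained by deleting index `j` does not vanish. -/
theorem det_submatrix_succAbove_ne_zero {n : ℕ} (M : Matrix (Fin (n + 1)) (Fin (n + 1)) ℝ)
    (hS : M.IsSymm) (hM : Module.finrank ℝ (LinearMap.ker M.mulVecLin) = 1)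
    {p : Fin (n + 1) → ℝ} (hp : M *ᵥ p = 0) {j : Fin (n + 1)} (hj : p j ≠ 0) :
    (M.submatrix j.succAbove j.succAbove).det ≠ 0 := by
  intro hdet
  obtain ⟨y, hy0, hy⟩ := exists_mulVec_eq_zero_iff.mpr hdet
  have hp0 : p ≠ 0 := fun h => hj (by simp [h])
  set x : Fin (n + 1) → ℝ := j.insertNth 0 y with hx
  have hoff : ∀ k, (M *ᵥ x) (j.succAbove k) = 0 := fun k => by
    have h := congrFun hy k
    simpa [mulVec, dotProduct, Fin.sum_univ_succAbove _ j, hx] using h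
  have hpx : p ⬝ᵥ (M *ᵥ x) = 0 := by
    rw [dotProduct_mulVec, ← mulVec_transpose, hS.eq, hp, zero_dotProduct]
  have hxj : (M *ᵥ x) j = 0 := by
    rw [dotProduct, Fin.sum_univ_succAbove _ j] at hpx
    simpa [hoff, hj] using hpx
  have hMx : M *ᵥ x = 0 := by
    ext i
    rcases Fin.eq_self_or_eq_succAbove j i with rfl | ⟨k, rfl⟩
    · exact hxj
    · exact hoff k
  obtain ⟨c, hc⟩ := exists_smul_of_finrank_ker_eq_one M hM hp hp0 hMx
  have hc0 : c = 0 := by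
    have h := congrFun hc j
    simpa [hx, hj] using h
  apply hy0
  ext k
  have h := congrFun hc (j.succAbove k)
  simpa [hx, hc0] using h

/-- Hypomorphic matrices have the same principal minors after subtracting a scalar matrix. -/
theorem Hypomorphic.det_submatrix_sub_smul_one {n : ℕ}
    {A B : Matrix (Fin (n + 1)) (Fin (n + 1)) ℝ} (h : Hypomorphic A B) (lam : ℝ)
    (j : Fin (n + 1)) :
    ((B - lam • (1 : Matrix _ _ ℝ)).submatrix j.succAbove j.succAbove).det =
      ((A - lam • (1 : Matrix _ _ ℝ)).submatrix j.succAbove j.succAbove).det := by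
  obtain ⟨σ, hσ⟩ := h j
  have hsub : ∀ C : Matrix (Fin (n + 1)) (Fin (n + 1)) ℝ,
      (C - lam • (1 : Matrix _ _ ℝ)).submatrix j.succAbove j.succAbove =
        C.submatrix j.succAbove j.succAbove - lam • (1 : Matrix _ _ ℝ) := fun C => by
    rw [← submatrix_one (α := ℝ) j.succAbove j.succAbove_right_injective]
    rfl
  have hone : σ.permMatrix ℝ * (σ.permMatrix ℝ)ᵀ = 1 := by
    rw [transpose_permMatrix, ← permMatrix_mul]
    simp
  have hconj : B.submatrix j.succAbove j.succAbove - lam • (1 : Matrix _ _ ℝ) =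
      σ.permMatrix ℝ * (A.submatrix j.succAbove j.succAbove - lam • (1 : Matrix _ _ ℝ)) *
        (σ.permMatrix ℝ)ᵀ := by
    rw [hσ, mul_sub, sub_mul, mul_smul_comm, mul_one, smul_mul_assoc, hone]
  have hdet : (σ.permMatrix ℝ).det * (σ.permMatrix ℝ)ᵀ.det = 1 := by
    rw [← det_mul, hone, det_one]
  rw [hsub, hsub, hconj, det_mul, det_mul, mul_right_comm, hdet, one_mul]

/-- **Godsil–McKay.** Let `A`, `B` be hypomorphic real symmetric matrices,
`lam` a simple eigenvalue of both `A` and `B`, `p` a unit eigenvector of `A` for `lam`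
and `q` a unit eigenvector of `B` for `lam`.  Then `(p j)^2 = (q j)^2` for all `j`. -/
theorem sq_entries_eq_of_hypomorphic {n : ℕ}
    (A B : Matrix (Fin (n + 1)) (Fin (n + 1)) ℝ) (hA : A.IsSymm) (hB : B.IsSymm)
    (hhypo : Hypomorphic A B)
    (lam : ℝ)
    (hsimpleA : Module.finrank ℝ
      (LinearMap.ker ((A - lam • (1 : Matrix (Fin (n + 1)) (Fin (n + 1)) ℝ)).mulVecLin)) = 1)
    (hsimpleB : Module.finrank ℝ
      (LinearMap.ker ((B - lam • (1 : Matrix (Fin (n + 1)) (Fin (n + 1)) ℝ)).mulVecLin)) = 1)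
    (p q : Fin (n + 1) → ℝ)
    (hp : A.mulVec p = lam • p) (hpu : p ⬝ᵥ p = 1)
    (hq : B.mulVec q = lam • q) (hqu : q ⬝ᵥ q = 1) :
    ∀ j, (p j) ^ 2 = (q j) ^ 2 := by
  have hSA : (A - lam • (1 : Matrix _ _ ℝ)).IsSymm := hA.sub (isSymm_one.smul lam)
  have hSB : (B - lam • (1 : Matrix _ _ ℝ)).IsSymm := hB.sub (isSymm_one.smul lam)
  have hp' : (A - lam • (1 : Matrix _ _ ℝ)) *ᵥ p = 0 := by
    rw [sub_mulVec, smul_mulVec, one_mulVec, hp, sub_self]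
  have hq' : (B - lam • (1 : Matrix _ _ ℝ)) *ᵥ q = 0 := by
    rw [sub_mulVec, smul_mulVec, one_mulVec, hq, sub_self]
  obtain ⟨c, hc⟩ := adjugate_diag_eq_mul_sq _ hSA hsimpleA hp' hpu
  obtain ⟨d, hd⟩ := adjugate_diag_eq_mul_sq _ hSB hsimpleB hq' hqu
  have hcd : ∀ j, c * p j ^ 2 = d * q j ^ 2 := fun j => by
    rw [← hc, ← hd, adjugate_diag_eq_det_submatrix, adjugate_diag_eq_det_submatrix,
      hhypo.det_submatrix_sub_smul_one]
  have hc_eq : c = d := by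
    calc c = c * (p ⬝ᵥ p) := by rw [hpu, mul_one]
      _ = ∑ j, c * p j ^ 2 := by simp [dotProduct, Finset.mul_sum, sq]
      _ = ∑ j, d * q j ^ 2 := Finset.sum_congr rfl fun j _ => hcd j
      _ = d * (q ⬝ᵥ q) := by simp [dotProduct, Finset.mul_sum, sq]
      _ = d := by rw [hqu, mul_one]
  have hc0 : c ≠ 0 := by
    have hp0 : p ≠ 0 := by
      rintro rfl
      simp at hpu
    obtain ⟨j, hj⟩ := Function.ne_iff.mp hp0
    have hmin := det_submatrix_succAbove_ne_zero _ hSA hsimpleA hp' hj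
    rw [← adjugate_diag_eq_det_submatrix, hc] at hmin
    exact left_ne_zero_of_mul hmin
  intro j
  have h := hcd j
  rw [← hc_eq] at h
  exact mul_left_cancel₀ hc0 h
end

section
/- Let t < 0 be a real number, let λ_1 > λ_2 > … > λ_n be real numbers, and let q_1, …, q_n be nonzero real numbers. Define P_t(λ) = 1 + Σ_{i=1}^n t q_i^2 / (λ_i − λ) for λ ∉ {λ_1,…,λ_n}. Then there exist real numbers μ_1, …, μ_n with λ_1 > μ_1 > λ_2 > μ_2 > … > λ_{n−1} > μ_{n−1} > λ_n > μ_n such that P_t(μ_k) = 0 for each k; moreover every λ ∉ {λ_1,…,λ_n} with P_t(λ) = 0 equals some μ_k. In particular, P_t has exactly one root in (−∞, λ_n) and exactly one root in each interval (λ_{i+1}, λ_i). -/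
open BigOperators Finset

open Filter Topology

section Secular

variable {ι : Type*} [Fintype ι] {c lam : ι → ℝ}

lemma continuousOn_secular {s : Set ℝ} (hs : ∀ i, lam i ∉ s) :
    ContinuousOn (fun x => 1 + ∑ i, c i / (lam i - x)) s := by
  refine continuousOn_const.add (continuousOn_finsetSum _ fun i _ => ?_)
  refine continuousOn_const.div (by fun_prop) fun x hx h => hs i ?_
  rwa [sub_eq_zero.1 h]

lemma secular_lt_secular [Nonempty ι] (hc : ∀ i, c i < 0) {x y : ℝ} (hxy : x < y)
    (h : ∀ i, lam i < x ∨ y < lam i) :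
    1 + ∑ i, c i / (lam i - y) < 1 + ∑ i, c i / (lam i - x) := by
  gcongr 1 + ?_
  refine Finset.sum_lt_sum_of_nonempty Finset.univ_nonempty fun i _ => ?_
  have hprod : 0 < (lam i - y) * (lam i - x) := by
    rcases h i with h | h
    · exact mul_pos_of_neg_of_neg (by linarith) (by linarith)
    · exact mul_pos (by linarith) (by linarith)
  have hy : lam i - y ≠ 0 := left_ne_zero_of_mul hprod.ne'
  have hx : lam i - x ≠ 0 := right_ne_zero_of_mul hprod.ne'
  have hdiff : c i / (lam i - y) - c i / (lam i - x)
      = c i * (y - x) / ((lam i - y) * (lam i - x)) := by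
    field_simp
    ring
  have := div_neg_of_neg_of_pos (mul_neg_of_neg_of_pos (hc i) (sub_pos.2 hxy)) hprod
  linarith

lemma secular_eq_add_erase [DecidableEq ι] (k : ι) :
    (fun x => 1 + ∑ i, c i / (lam i - x)) =
      fun x => c k / (lam k - x) + (1 + ∑ i ∈ Finset.univ.erase k, c i / (lam i - x)) := by
  ext x
  rw [← Finset.add_sum_erase _ _ (Finset.mem_univ k)]
  ring

lemma continuousAt_secular_erase [DecidableEq ι] (hlam : Function.Injective lam) (k : ι) :
    ContinuousAt (fun x => 1 + ∑ i ∈ Finset.univ.erase k, c i / (lam i - x)) (lam k) := by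
  refine continuousAt_const.add (tendsto_finsetSum _ fun i hi => ?_)
  exact continuousAt_const.div (by fun_prop)
    (sub_ne_zero.2 (hlam.ne (Finset.ne_of_mem_erase hi)))

lemma tendsto_secular_nhdsLT (hlam : Function.Injective lam) (k : ι) (hc : c k < 0) :
    Tendsto (fun x => 1 + ∑ i, c i / (lam i - x)) (𝓝[<] (lam k)) atBot := by
  classical
  rw [secular_eq_add_erase k]
  refine Tendsto.atBot_add ?_
    ((continuousAt_secular_erase hlam k).tendsto.mono_left nhdsWithin_le_nhds)
  have h : Tendsto (fun x => lam k - x) (𝓝[<] (lam k)) (𝓝[>] 0) := by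
    refine tendsto_nhdsWithin_iff.2 ⟨?_, ?_⟩
    · have : ContinuousAt (fun x => lam k - x) (lam k) := by fun_prop
      simpa [ContinuousAt] using this.tendsto.mono_left nhdsWithin_le_nhds
    · filter_upwards [self_mem_nhdsWithin] with x hx using sub_pos.2 (Set.mem_Iio.1 hx)
  simpa only [div_eq_mul_inv, Function.comp_apply] using
    (tendsto_inv_nhdsGT_zero.comp h).const_mul_atTop_of_neg hc

lemma tendsto_secular_nhdsGT (hlam : Function.Injective lam) (k : ι) (hc : c k < 0) :
    Tendsto (fun x => 1 + ∑ i, c i / (lam i - x)) (𝓝[>] (lam k)) atTop := by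
  classical
  rw [secular_eq_add_erase k]
  refine Tendsto.atTop_add ?_
    ((continuousAt_secular_erase hlam k).tendsto.mono_left nhdsWithin_le_nhds)
  have h : Tendsto (fun x => lam k - x) (𝓝[>] (lam k)) (𝓝[<] 0) := by
    refine tendsto_nhdsWithin_iff.2 ⟨?_, ?_⟩
    · have : ContinuousAt (fun x => lam k - x) (lam k) := by fun_prop
      simpa [ContinuousAt] using this.tendsto.mono_left nhdsWithin_le_nhds
    · filter_upwards [self_mem_nhdsWithin] with x hx using sub_neg.2 (Set.mem_Ioi.1 hx)
  simpa only [div_eq_mul_inv, Function.comp_apply] using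
    (tendsto_inv_nhdsLT_zero.comp h).const_mul_atBot_of_neg hc

lemma tendsto_secular_atBot :
    Tendsto (fun x => 1 + ∑ i, c i / (lam i - x)) atBot (𝓝 1) := by
  have h (i : ι) : Tendsto (fun x => c i / (lam i - x)) atBot (𝓝 0) :=
    Tendsto.const_div_atTop (tendsto_atTop_add_const_left _ _ tendsto_neg_atBot_atTop) _
  simpa using (tendsto_finsetSum Finset.univ fun i _ => h i).const_add 1

end Secular

lemma exists_secular_root {n : ℕ} {c lam : Fin n → ℝ} (hlam : StrictAnti lam)
    (hc : ∀ i, c i < 0) (k : Fin n) :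
    ∃ x, x < lam k ∧ (∀ h : (k : ℕ) + 1 < n, lam ⟨(k : ℕ) + 1, h⟩ < x) ∧
      1 + ∑ i, c i / (lam i - x) = 0 := by
  have hleft := tendsto_secular_nhdsLT hlam.injective k (hc k)
  by_cases hk : (k : ℕ) + 1 < n
  · set j : Fin n := ⟨(k : ℕ) + 1, hk⟩ with hj
    have hjk : lam j < lam k := hlam (Fin.lt_def.2 (Nat.lt_succ_self _))
    have hgap (i : Fin n) : lam i ∉ Set.Ioo (lam j) (lam k) := fun hi => by
      have h₁ := Fin.lt_def.1 (hlam.lt_iff_gt.1 hi.1)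
      have h₂ := Fin.lt_def.1 (hlam.lt_iff_gt.1 hi.2)
      simp only [hj] at h₁
      omega
    have hleft_le : 𝓝[<] (lam k) ≤ 𝓟 (Set.Ioo (lam j) (lam k)) :=
      le_principal_iff.2 (Ioo_mem_nhdsLT hjk)
    have hright_le : 𝓝[>] (lam j) ≤ 𝓟 (Set.Ioo (lam j) (lam k)) :=
      le_principal_iff.2 (Ioo_mem_nhdsGT hjk)
    obtain ⟨x, hx, hx0⟩ := isPreconnected_Ioo.intermediate_value_Iii hleft_le hright_le
      (continuousOn_secular hgap) hleft (tendsto_secular_nhdsGT hlam.injective j (hc j))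
      (Set.mem_univ (0 : ℝ))
    exact ⟨x, hx.2, fun _ => hx.1, hx0⟩
  · have hgap (i : Fin n) : lam i ∉ Set.Iio (lam k) := fun hi => by
      have := Fin.lt_def.1 (hlam.lt_iff_gt.1 hi)
      omega
    have hleft_le : 𝓝[<] (lam k) ≤ 𝓟 (Set.Iio (lam k)) := le_principal_iff.2 self_mem_nhdsWithin
    have hbot_le : (atBot : Filter ℝ) ≤ 𝓟 (Set.Iio (lam k)) :=
      le_principal_iff.2 (Iio_mem_atBot _)
    obtain ⟨x, hx, hx0⟩ := isPreconnected_Iio.intermediate_value_Iio hleft_le hbot_le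
      (continuousOn_secular hgap) hleft tendsto_secular_atBot
      (Set.mem_Iio.2 (zero_lt_one' ℝ))
    exact ⟨x, hx, fun h => absurd h hk, hx0⟩

lemma exists_mem_gap_of_secular_root {n : ℕ} {c lam : Fin n → ℝ} (hc : ∀ i, c i < 0)
    {x : ℝ} (hx : x ∉ Set.range lam) (hx0 : 1 + ∑ i, c i / (lam i - x) = 0) :
    ∃ k, x < lam k ∧ ∀ i, k < i → lam i < x := by
  have hne : (Finset.univ.filter fun i => x < lam i).Nonempty := by
    by_contra! hempty
    have hlt (i : Fin n) : lam i ≤ x :=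
      not_lt.1 (Finset.filter_eq_empty_iff.1 hempty (Finset.mem_univ i))
    have : 0 ≤ ∑ i, c i / (lam i - x) := Finset.sum_nonneg fun i _ =>
      div_nonneg_of_nonpos (hc i).le (sub_nonpos.2 (hlt i))
    linarith
  refine ⟨_, (Finset.mem_filter.1 (Finset.max'_mem _ hne)).2, fun i hi => ?_⟩
  refine lt_of_le_of_ne (not_lt.1 fun hxi => ?_) fun h => hx ⟨i, h⟩
  exact hi.not_ge (Finset.le_max' _ _ (by simpa using hxi))

/-- **Lemma on interlacing roots.** Fix `t < 0`, strictly decreasing reals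
`lam 0 > lam 1 > … > lam (n-1)`, and nonzero reals `q i`.  Consider
`P_t (x) = 1 + ∑ i, t * (q i)^2 / (lam i - x)` for `x ∉ {lam 0, …, lam (n-1)}`.
Then there are reals `mu k` interlacing the `lam`'s, i.e.
`lam 0 > mu 0 > lam 1 > mu 1 > … > lam (n-1) > mu (n-1)`,
which are roots of `P_t`, and every root of `P_t` (outside the poles) is one of the `mu k`.
In particular `P_t` has exactly one root below `lam (n-1)` and exactly one root in each
interval `(lam (i+1), lam i)`. -/
theorem roots_interlace_of_neg_t {n : ℕ} (t : ℝ) (ht : t < 0)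
    (lam : Fin n → ℝ) (hlam : StrictAnti lam)
    (q : Fin n → ℝ) (hq : ∀ i, q i ≠ 0) :
    ∃ mu : Fin n → ℝ,
      (∀ k : Fin n, mu k < lam k) ∧
      (∀ k : Fin n, ∀ h : (k : ℕ) + 1 < n, lam ⟨(k : ℕ) + 1, h⟩ < mu k) ∧
      (∀ k : Fin n, 1 + ∑ i, t * (q i) ^ 2 / (lam i - mu k) = 0) ∧
      (∀ x : ℝ, x ∉ Set.range lam →
        1 + ∑ i, t * (q i) ^ 2 / (lam i - x) = 0 → ∃ k, x = mu k) := by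
  have hc (i : Fin n) : t * q i ^ 2 < 0 :=
    mul_neg_of_neg_of_pos ht (sq_pos_of_ne_zero (hq i))
  choose mu hmu_lt hmu_gt hmu_root using exists_secular_root hlam hc
  refine ⟨mu, hmu_lt, hmu_gt, hmu_root, fun x hx hx0 => ?_⟩
  obtain ⟨k, hxk, hkx⟩ := exists_mem_gap_of_secular_root hc hx hx0
  have : Nonempty (Fin n) := ⟨k⟩
  have hmu_after (i : Fin n) (hi : k < i) : lam i < mu k :=
    (hlam.antitone (Fin.le_def.2 (Nat.succ_le_of_lt hi))).trans_lt
      (hmu_gt k ((Nat.succ_le_of_lt hi).trans_lt i.isLt))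
  have hbefore (i : Fin n) (hi : i ≤ k) : lam k ≤ lam i := hlam.antitone hi
  refine ⟨k, ?_⟩
  rcases lt_trichotomy x (mu k) with h | h | h
  · have := secular_lt_secular (lam := lam) hc h fun i => (lt_or_ge k i).imp (hkx i)
      fun hi => (hmu_lt k).trans_le (hbefore i hi)
    linarith [hmu_root k]
  · exact h
  · have := secular_lt_secular (lam := lam) hc h fun i => (lt_or_ge k i).imp (hmu_after i)
      fun hi => hxk.trans_le (hbefore i hi)
    linarith [hmu_root k]
end

section
/- Let A be an n×n real symmetric matrix with real eigenvalues λ_1, …, λ_n (listed with multiplicity) and an orthonormal basis p_1, …, p_n of ℝ^n with A p_j = λ_j p_j for each j. Let x ∈ ℝ^n, set q_i = ⟨p_i, x⟩, and let t be a real number. Suppose μ is a real number with μ ≠ λ_i for all i satisfying 1 + Σ_{i=1}^n t q_i^2 / (λ_i − μ) = 0. Then the vector v = Σ_{i=1}^n (q_i / (λ_i − μ)) p_i is nonzero and satisfies (A + t·x x^T) v = μ v; i.e. v is an eigenvector of A + t·x x^T with eigenvalue μ. -/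
open Matrix BigOperators Finset

/-- Expansion of a vector in an orthonormal family of full size. -/
theorem sum_dotProduct_smul_eq_self {n : Type*} [Fintype n] [DecidableEq n]
    (p : n → n → ℝ) (horth : ∀ j k, p j ⬝ᵥ p k = if j = k then (1 : ℝ) else 0) (x : n → ℝ) :
    ∑ i, (p i ⬝ᵥ x) • p i = x := by
  have hP : Matrix.of p * (Matrix.of p)ᵀ = 1 := by
    ext j k
    rw [Matrix.one_apply, ← horth j k]
    rfl
  calc ∑ i, (p i ⬝ᵥ x) • p i = (Matrix.of p)ᵀ *ᵥ (Matrix.of p *ᵥ x) := by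
        ext k
        simp [Matrix.mulVec, dotProduct, mul_comm]
    _ = x := by rw [Matrix.mulVec_mulVec, mul_eq_one_comm.mp hP, Matrix.one_mulVec]

/-- Let `A` be a real symmetric matrix with orthonormal eigenbasis `p j`
and eigenvalues `lam j`, let `x` be a vector, `q i = ⟨p i, x⟩`, and `t` real.  If `mu` is
a real number with `mu ≠ lam i` for all `i` satisfying
`1 + ∑ i, t * (q i)^2 / (lam i - mu) = 0`, then
`v = ∑ i, (q i / (lam i - mu)) • p i` is nonzero and `(A + t • x xᵀ) v = mu • v`. -/
theorem eigenvector_of_rank_one_perturbation {n : ℕ}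
    (A : Matrix (Fin n) (Fin n) ℝ) (hA : A.IsSymm)
    (lam : Fin n → ℝ) (p : Fin n → (Fin n → ℝ))
    (horth : ∀ j k, p j ⬝ᵥ p k = if j = k then (1 : ℝ) else 0)
    (heig : ∀ j, A.mulVec (p j) = lam j • p j)
    (x : Fin n → ℝ) (t : ℝ) (mu : ℝ) (hmu : ∀ i, mu ≠ lam i)
    (hroot : 1 + ∑ i, t * (p i ⬝ᵥ x) ^ 2 / (lam i - mu) = 0) :
    (∑ i, (p i ⬝ᵥ x / (lam i - mu)) • p i) ≠ 0 ∧
    (A + t • Matrix.vecMulVec x x).mulVec (∑ i, (p i ⬝ᵥ x / (lam i - mu)) • p i)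
      = mu • ∑ i, (p i ⬝ᵥ x / (lam i - mu)) • p i := by
  have hdot : t * (x ⬝ᵥ ∑ i, (p i ⬝ᵥ x / (lam i - mu)) • p i) = -1 := by
    rw [dotProduct_sum, Finset.mul_sum, eq_neg_iff_add_eq_zero, add_comm, ← hroot]
    congr 1
    refine Finset.sum_congr rfl fun i _ => ?_
    rw [dotProduct_smul, dotProduct_comm x, smul_eq_mul]
    ring
  refine ⟨fun h => by simp [h] at hdot, ?_⟩
  have hrank (v : Fin n → ℝ) : (t • vecMulVec x x) *ᵥ v = (t * (x ⬝ᵥ v)) • x := by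
    rw [smul_mulVec, vecMulVec_mulVec, op_smul_eq_smul, smul_smul]
  rw [add_mulVec, hrank, hdot, neg_one_smul, ← sub_eq_add_neg, sub_eq_iff_eq_add]
  nth_rewrite 3 [← sum_dotProduct_smul_eq_self p horth x]
  rw [mulVec_sum, Finset.smul_sum, ← Finset.sum_add_distrib]
  refine Finset.sum_congr rfl fun i _ => ?_
  have hi : lam i - mu ≠ 0 := sub_ne_zero.mpr (hmu i).symm
  rw [mulVec_smul, heig, smul_smul, smul_smul, ← add_smul]
  congr 1
  field_simp
  ring
end

section
/- Let A be an n×n real symmetric matrix, x ∈ ℝ^n, and t < 0 a real number. Let λ_{i_1} > λ_{i_2} > … > λ_{i_l} be exactly those distinct eigenvalues λ of A whose eigenspace ker(A − λI) is not orthogonal to x. Then there exist real numbers μ_1, …, μ_l with λ_{i_1} > μ_1 > λ_{i_2} > μ_2 > … > λ_{i_l} > μ_l such that the multiset of eigenvalues of A + t·x x^T (with multiplicity) is obtained from the multiset of eigenvalues of A by removing one copy of each λ_{i_j} and adding μ_1, …, μ_l. -/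
open Matrix BigOperators Finset

/-- The secular polynomial `∏ k, (X - lam k) + ∑ k, w k * ∏ j ≠ k, (X - lam j)`, that is, the
numerator of the rational function `1 + ∑ k, w k / (X - lam k)`. -/
noncomputable def secularPoly {l : ℕ} (lam w : Fin l → ℝ) : Polynomial ℝ :=
  ∏ k, (Polynomial.X - Polynomial.C (lam k)) +
    ∑ k, Polynomial.C (w k) * ∏ j ∈ univ.erase k, (Polynomial.X - Polynomial.C (lam j))

lemma eval_secularPoly {l : ℕ} (lam w : Fin l → ℝ) (z : ℝ) :
    (secularPoly lam w).eval z =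
      ∏ k, (z - lam k) + ∑ k, w k * ∏ j ∈ univ.erase k, (z - lam j) := by
  simp [secularPoly, Polynomial.eval_finsetSum, Polynomial.eval_prod]

lemma eval_secularPoly_self {l : ℕ} (lam w : Fin l → ℝ) (k : Fin l) :
    (secularPoly lam w).eval (lam k) = w k * ∏ j ∈ univ.erase k, (lam k - lam j) := by
  rw [eval_secularPoly, Finset.prod_eq_zero (mem_univ k) (sub_self _), zero_add]
  refine Finset.sum_eq_single k (fun b _ hb => ?_) (by simp)
  rw [Finset.prod_eq_zero (mem_erase.2 ⟨hb.symm, mem_univ k⟩) (sub_self _), mul_zero]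

lemma natDegree_secularPoly_le {l : ℕ} (lam w : Fin l → ℝ) :
    (secularPoly lam w).natDegree ≤ l := by
  refine Polynomial.natDegree_add_le_of_degree_le ?_ ?_
  · refine (Polynomial.natDegree_prod_le _ _).trans ?_
    simp
  · refine Polynomial.natDegree_sum_le_of_forall_le _ _ fun k _ => ?_
    refine (Polynomial.natDegree_C_mul_le _ _).trans ((Polynomial.natDegree_prod_le _ _).trans ?_)
    simp

lemma Polynomial.exists_root_mem_Ioo_of_mul_neg (p : Polynomial ℝ) {a b : ℝ} (hab : a < b)
    (h : p.eval a * p.eval b < 0) : ∃ c, a < c ∧ c < b ∧ p.eval c = 0 := by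
  have hc : ContinuousOn (fun z => p.eval z) (Set.Icc a b) := p.continuous.continuousOn
  rcases mul_neg_iff.1 h with ⟨ha, hb⟩ | ⟨ha, hb⟩
  · obtain ⟨c, hc, h0⟩ := intermediate_value_Ioo' hab.le hc (Set.mem_Ioo.2 ⟨hb, ha⟩)
    exact ⟨c, hc.1, hc.2, h0⟩
  · obtain ⟨c, hc, h0⟩ := intermediate_value_Ioo hab.le hc (Set.mem_Ioo.2 ⟨ha, hb⟩)
    exact ⟨c, hc.1, hc.2, h0⟩

lemma secularPoly_exists_root_between {l : ℕ} {lam w : Fin l → ℝ} (hlam : StrictAnti lam)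
    (hw : ∀ k, 0 < w k) (k : Fin l) (h : (k : ℕ) + 1 < l) :
    ∃ c, lam ⟨(k : ℕ) + 1, h⟩ < c ∧ c < lam k ∧ (secularPoly lam w).eval c = 0 := by
  set k' : Fin l := ⟨(k : ℕ) + 1, h⟩ with hk'
  have hkk : k < k' := Fin.lt_def.2 (Nat.lt_succ_self _)
  have hlt : lam k' < lam k := hlam hkk
  refine Polynomial.exists_root_mem_Ioo_of_mul_neg _ hlt ?_
  rw [eval_secularPoly_self, eval_secularPoly_self,
    ← Finset.mul_prod_erase (univ.erase k') _ (mem_erase.2 ⟨hkk.ne, mem_univ k⟩),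
    ← Finset.mul_prod_erase (univ.erase k) _ (mem_erase.2 ⟨hkk.ne', mem_univ k'⟩),
    Finset.erase_right_comm]
  have hpos : 0 < (∏ j ∈ (univ.erase k).erase k', (lam k' - lam j)) *
      ∏ j ∈ (univ.erase k).erase k', (lam k - lam j) := by
    rw [← Finset.prod_mul_distrib]
    refine Finset.prod_pos fun j hj => ?_
    have hjk' : j ≠ k' := (mem_erase.1 hj).1
    have hjk : j ≠ k := (mem_erase.1 (mem_erase.1 hj).2).1
    have hcases : j < k ∨ k' < j := by
      simp only [Fin.lt_def, ne_eq, Fin.ext_iff, hk'] at *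
      omega
    rcases hcases with hj | hj
    · exact mul_pos_of_neg_of_neg (sub_neg.2 (hlam (hj.trans hkk))) (sub_neg.2 (hlam hj))
    · exact mul_pos (sub_pos.2 (hlam hj)) (sub_pos.2 (hlam (hkk.trans hj)))
  have h1 : 0 < w k' * w k * ((lam k - lam k') * (lam k - lam k')) :=
    mul_pos (mul_pos (hw _) (hw _)) (mul_pos (sub_pos.2 hlt) (sub_pos.2 hlt))
  nlinarith [mul_pos h1 hpos]

lemma secularPoly_exists_root_lt {l : ℕ} {lam w : Fin l → ℝ} (hlam : StrictAnti lam)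
    (hw : ∀ k, 0 < w k) (k : Fin l) (h : ¬ (k : ℕ) + 1 < l) :
    ∃ c, c < lam k ∧ (secularPoly lam w).eval c = 0 := by
  have hlast : ∀ j, j ≠ k → lam k < lam j := fun j hj => hlam (by
    simp only [Fin.lt_def, ne_eq, Fin.ext_iff] at *
    omega)
  set S := ∑ j, w j with hS
  have hS0 : 0 ≤ S := Finset.sum_nonneg fun j _ => (hw j).le
  set a := lam k - S - 1 with ha
  have hak : a < lam k := by linarith
  have haj : ∀ j, S + 1 ≤ lam j - a := fun j => by
    rcases eq_or_ne j k with rfl | hj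
    · linarith
    · linarith [hlast j hj]
  have hf : 0 < 1 + ∑ j, w j / (a - lam j) := by
    have h1 : ∑ j, w j / (lam j - a) ≤ ∑ j, w j / (S + 1) :=
      Finset.sum_le_sum fun j _ => div_le_div_of_nonneg_left (hw j).le (by linarith) (haj j)
    have h2 : ∑ j, w j / (a - lam j) = - ∑ j, w j / (lam j - a) := by
      rw [← Finset.sum_neg_distrib]
      exact Finset.sum_congr rfl fun j _ => by rw [← neg_sub (lam j) a, div_neg]
    rw [← Finset.sum_div] at h1
    have h3 : S / (S + 1) < 1 := (div_lt_one (by linarith)).2 (by linarith)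
    linarith
  have hval : (secularPoly lam w).eval a =
      (∏ j, (a - lam j)) * (1 + ∑ j, w j / (a - lam j)) := by
    rw [eval_secularPoly, mul_add, mul_one, Finset.mul_sum]
    congr 1
    refine Finset.sum_congr rfl fun j _ => ?_
    rw [← Finset.mul_prod_erase univ _ (mem_univ j)]
    have : a - lam j ≠ 0 := by linarith [haj j]
    field_simp
  suffices hneg : (secularPoly lam w).eval a * (secularPoly lam w).eval (lam k) < 0 by
    obtain ⟨c, -, hc, h0⟩ := Polynomial.exists_root_mem_Ioo_of_mul_neg _ hak hneg
    exact ⟨c, hc, h0⟩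
  rw [hval, eval_secularPoly_self, ← Finset.mul_prod_erase univ _ (mem_univ k)]
  have hpos : 0 < (∏ j ∈ univ.erase k, (a - lam j)) * ∏ j ∈ univ.erase k, (lam k - lam j) := by
    rw [← Finset.prod_mul_distrib]
    refine Finset.prod_pos fun j hj => ?_
    exact mul_pos_of_neg_of_neg (by linarith [haj j]) (sub_neg.2 (hlast j (mem_erase.1 hj).1))
  nlinarith [mul_pos (mul_pos (mul_pos (hw k) hf) (sub_pos.2 hak)) hpos]

lemma secularPoly_ne_zero {l : ℕ} {lam w : Fin l → ℝ} (hlam : Function.Injective lam)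
    (hw : ∀ k, 0 < w k) : secularPoly lam w ≠ 0 := by
  rcases l with _ | l
  · simp [secularPoly]
  · intro h
    have h0 := eval_secularPoly_self lam w 0
    rw [h, Polynomial.eval_zero, eq_comm, mul_eq_zero, or_iff_right (hw 0).ne',
      Finset.prod_eq_zero_iff] at h0
    obtain ⟨j, hj, hj0⟩ := h0
    exact (mem_erase.1 hj).1 (hlam (sub_eq_zero.1 hj0)).symm

/-- The roots of the secular polynomial with positive weights strictly interlace its poles. -/
lemma secularPoly_roots_interlace {l : ℕ} {lam w : Fin l → ℝ} (hlam : StrictAnti lam)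
    (hw : ∀ k, 0 < w k) :
    ∃ mu : Fin l → ℝ, (∀ k, mu k < lam k) ∧
      (∀ k : Fin l, ∀ h : (k : ℕ) + 1 < l, lam ⟨(k : ℕ) + 1, h⟩ < mu k) ∧
      (secularPoly lam w).roots = Multiset.map mu univ.val := by
  have hex : ∀ k : Fin l, ∃ c, c < lam k ∧
      (∀ h : (k : ℕ) + 1 < l, lam ⟨(k : ℕ) + 1, h⟩ < c) ∧ (secularPoly lam w).eval c = 0 := by
    intro k
    by_cases h : (k : ℕ) + 1 < l
    · obtain ⟨c, h1, h2, h3⟩ := secularPoly_exists_root_between hlam hw k h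
      exact ⟨c, h2, fun _ => h1, h3⟩
    · obtain ⟨c, h1, h2⟩ := secularPoly_exists_root_lt hlam hw k h
      exact ⟨c, h1, fun h' => absurd h' h, h2⟩
  choose mu h1 h2 h3 using hex
  refine ⟨mu, h1, h2, ?_⟩
  have hanti : StrictAnti mu := by
    intro i j hij
    have hi : (i : ℕ) + 1 < l := lt_of_le_of_lt (Fin.lt_def.1 hij) j.2
    have hle : lam j ≤ lam ⟨(i : ℕ) + 1, hi⟩ := hlam.antitone (Fin.le_def.2 (Fin.lt_def.1 hij))
    linarith [h1 j, h2 i hi]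
  have hne := secularPoly_ne_zero hlam.injective hw
  refine (Multiset.eq_of_le_of_card_le ?_ ?_).symm
  · refine (Multiset.le_iff_subset (univ.nodup.map hanti.injective)).2 fun c hc => ?_
    obtain ⟨k, -, rfl⟩ := Multiset.mem_map.1 hc
    exact (Polynomial.mem_roots hne).2 (h3 k)
  · simpa using (Polynomial.card_roots' _).trans (natDegree_secularPoly_le lam w)

lemma Matrix.IsSymm.exists_eigenbasis {n : ℕ} {A : Matrix (Fin n) (Fin n) ℝ} (hA : A.IsSymm) :
    ∃ (d : Fin n → ℝ) (e : Fin n → Fin n → ℝ), (∀ i, A *ᵥ e i = d i • e i) ∧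
      ∀ v : Fin n → ℝ, ∑ i, (e i ⬝ᵥ v) • e i = v := by
  have hH : A.IsHermitian := by rw [Matrix.IsHermitian, conjTranspose_eq_transpose_of_trivial, hA]
  refine ⟨hH.eigenvalues, fun i => hH.eigenvectorBasis i, hH.mulVec_eigenvectorBasis, fun v => ?_⟩
  have h := congrArg WithLp.ofLp (hH.eigenvectorBasis.sum_repr' (WithLp.toLp 2 v))
  simpa [EuclideanSpace.inner_eq_star_dotProduct, dotProduct_comm] using h

lemma Matrix.det_sub_smul_vecMulVec_of_mulVec_eq {n : ℕ} {N : Matrix (Fin n) (Fin n) ℝ}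
    {x y : Fin n → ℝ} (t : ℝ) (h : N *ᵥ y = x) :
    (N - t • vecMulVec x x).det = N.det * (1 - t * (x ⬝ᵥ y)) := by
  have hfac : N - t • vecMulVec x x =
      N * (1 + replicateCol Unit (-t • y) * replicateRow Unit x) := by
    rw [← vecMulVec_eq, mul_add, mul_one, mul_vecMulVec, mulVec_smul, h, smul_vecMulVec]
    simp [sub_eq_add_neg]
  rw [hfac, det_mul, det_one_add_replicateCol_mul_replicateRow]
  simp [sub_eq_add_neg]

lemma charpoly_rank_one_mul_prod {n l : ℕ} {A : Matrix (Fin n) (Fin n) ℝ} {x : Fin n → ℝ} (t : ℝ)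
    {lam : Fin l → ℝ} (hlam : Function.Injective lam) {d : Fin n → ℝ} {e : Fin n → Fin n → ℝ}
    (he : ∀ i, A *ᵥ e i = d i • e i) (hx : ∑ i, (e i ⬝ᵥ x) • e i = x)
    (hd : ∀ i, e i ⬝ᵥ x ≠ 0 → d i ∈ Set.range lam) :
    (A + t • vecMulVec x x).charpoly * ∏ k, (Polynomial.X - Polynomial.C (lam k)) =
      A.charpoly *
        secularPoly lam (fun k => -t * ∑ i, if d i = lam k then (e i ⬝ᵥ x) ^ 2 else 0) := by
  refine mul_left_cancel₀ A.charpoly_monic.ne_zero (Polynomial.funext fun z => ?_)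
  simp only [Polynomial.eval_mul]
  by_cases hz : A.charpoly.eval z = 0
  · rw [hz, zero_mul, zero_mul]
  congr 1
  have hdz : ∀ i, e i ⬝ᵥ x ≠ 0 → z - d i ≠ 0 := by
    intro i hi h0
    apply hz
    rw [eval_charpoly, ← exists_mulVec_eq_zero_iff]
    refine ⟨e i, fun h => hi (by simp [h]), ?_⟩
    rw [sub_mulVec, he, scalar_apply, ← smul_one_eq_diagonal, smul_mulVec, one_mulVec, ← sub_smul,
      h0, zero_smul]
  have hy : (scalar (Fin n) z - A) *ᵥ (∑ i, ((e i ⬝ᵥ x) / (z - d i)) • e i) = x := by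
    conv_rhs => rw [← hx]
    rw [mulVec_sum]
    refine Finset.sum_congr rfl fun i _ => ?_
    by_cases hi : e i ⬝ᵥ x = 0
    · simp [hi]
    · rw [mulVec_smul, sub_mulVec, he, scalar_apply, ← smul_one_eq_diagonal, smul_mulVec,
        one_mulVec, ← sub_smul, smul_smul, div_mul_cancel₀ _ (hdz i hi)]
  have hsec : (x ⬝ᵥ ∑ i, ((e i ⬝ᵥ x) / (z - d i)) • e i) * ∏ k, (z - lam k) =
      ∑ k, (∑ i, if d i = lam k then (e i ⬝ᵥ x) ^ 2 else 0) *
        ∏ j ∈ univ.erase k, (z - lam j) := by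
    simp only [Finset.sum_mul]
    rw [Finset.sum_comm, dotProduct_sum, Finset.sum_mul]
    refine Finset.sum_congr rfl fun i _ => ?_
    by_cases hi : e i ⬝ᵥ x = 0
    · simp [hi]
    obtain ⟨k, hk⟩ := hd i hi
    rw [Finset.sum_eq_single k (fun b _ hb => ?_) (by simp), if_pos hk.symm,
      ← Finset.mul_prod_erase univ _ (mem_univ k), hk, dotProduct_smul, smul_eq_mul,
      dotProduct_comm x]
    · have := hdz i hi
      field_simp
    · rw [if_neg (fun h => hb (hlam (hk.trans h)).symm), zero_mul]
  rw [eval_secularPoly, eval_charpoly, eval_charpoly, ← sub_sub,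
    det_sub_smul_vecMulVec_of_mulVec_eq t hy, Polynomial.eval_prod]
  simp only [Polynomial.eval_sub, Polynomial.eval_X, Polynomial.eval_C, mul_assoc]
  rw [← Finset.mul_sum]
  linear_combination (-(scalar (Fin n) z - A).det * t) * hsec

/-- **Theorem on rank-one perturbation, `t < 0`.** Let `A` be a real
symmetric matrix, `x` a vector, `t < 0`.  Let `lam 0 > lam 1 > … > lam (l-1)` enumerate
exactly those distinct eigenvalues of `A` whose eigenspace is not orthogonal to `x`
(i.e. the reals `μ` admitting `v` with `A v = μ • v` and `⟨v, x⟩ ≠ 0`).  Then there are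
reals `mu k` with `lam 0 > mu 0 > lam 1 > mu 1 > … > lam (l-1) > mu (l-1)` such that the
multiset of eigenvalues of `A + t • x xᵀ` is obtained from that of `A` by removing one
copy of each `lam k` and adding the `mu k` (stated as an equality of multisets of roots
of the characteristic polynomials). -/
theorem spectrum_rank_one_perturbation_neg {n l : ℕ}
    (A : Matrix (Fin n) (Fin n) ℝ) (hA : A.IsSymm)
    (x : Fin n → ℝ) (t : ℝ) (ht : t < 0)
    (lam : Fin l → ℝ) (hlam : StrictAnti lam)
    (hexact : ∀ μ : ℝ,
      (∃ v : Fin n → ℝ, A.mulVec v = μ • v ∧ v ⬝ᵥ x ≠ 0) ↔ μ ∈ Set.range lam) :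
    ∃ mu : Fin l → ℝ,
      (∀ k : Fin l, mu k < lam k) ∧
      (∀ k : Fin l, ∀ h : (k : ℕ) + 1 < l, lam ⟨(k : ℕ) + 1, h⟩ < mu k) ∧
      (A + t • Matrix.vecMulVec x x).charpoly.roots + Multiset.map lam Finset.univ.val
        = A.charpoly.roots + Multiset.map mu Finset.univ.val := by
  obtain ⟨d, e, he, hsum⟩ := hA.exists_eigenbasis
  have hd : ∀ i, e i ⬝ᵥ x ≠ 0 → d i ∈ Set.range lam := fun i hi => (hexact _).1 ⟨e i, he i, hi⟩
  have hw : ∀ k, 0 < -t * ∑ i, if d i = lam k then (e i ⬝ᵥ x) ^ 2 else 0 := by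
    intro k
    obtain ⟨v, hv, hvx⟩ := (hexact (lam k)).2 ⟨k, rfl⟩
    rw [← hsum x, dotProduct_sum] at hvx
    obtain ⟨i, -, hi⟩ := Finset.exists_ne_zero_of_sum_ne_zero hvx
    rw [dotProduct_smul, smul_eq_mul] at hi
    have hdi : d i = lam k := by
      have h : (A *ᵥ v) ⬝ᵥ e i = v ⬝ᵥ (A *ᵥ e i) := by
        rw [dotProduct_mulVec, ← mulVec_transpose, hA.eq]
      rw [hv, he, smul_dotProduct, dotProduct_smul, smul_eq_mul, smul_eq_mul] at h
      exact (mul_right_cancel₀ (right_ne_zero_of_mul hi) h).symm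
    refine mul_pos (neg_pos.2 ht) (Finset.sum_pos' (fun j _ => by positivity) ⟨i, mem_univ i, ?_⟩)
    rw [if_pos hdi]
    exact sq_pos_of_ne_zero (left_ne_zero_of_mul hi)
  obtain ⟨mu, h1, h2, hroots⟩ := secularPoly_roots_interlace hlam hw
  refine ⟨mu, h1, h2, ?_⟩
  have h := congrArg Polynomial.roots
    (charpoly_rank_one_mul_prod t hlam.injective he (hsum x) hd)
  have hlamroots : (∏ k, (Polynomial.X - Polynomial.C (lam k))).roots =
      Multiset.map lam univ.val := by
    rw [← Polynomial.roots_multiset_prod_X_sub_C (univ.val.map lam), Multiset.map_map]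
    rfl
  have hprod := Polynomial.monic_prod_X_sub_C lam univ
  rwa [Polynomial.roots_mul (mul_ne_zero (charpoly_monic _).ne_zero hprod.ne_zero),
    Polynomial.roots_mul (mul_ne_zero (charpoly_monic _).ne_zero
      (secularPoly_ne_zero hlam.injective hw)), hroots, hlamroots] at h
end
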